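/- Let φ be a nonconstant inner function. The set Iso(φ) of positive Borel measures μ on T satisfying ∫_T |g*|² dμ = ‖g‖²_{H²} for every g in the disc algebra intersected with the model space H(φ) is convex and weak-* compact in the space of finite positive Borel measures on T. -/

import Mathlib

open Complex MeasureTheory Metric Set Filter
open scoped Topology ComplexConjugate Real NNReal

/-- Normalized Lebesgue (Haar) measure on the unit circle, realized as a
measure on `ℂ`. -/
noncomputable def circleHaar : Measure ℂ :=
  (ENNReal.ofReal (2 * π)⁻¹) •
    Measure.map (fun t : ℝ => Complex.exp (t * Complex.I))
      (volume.restrict (Ioc (0:ℝ) (2 * π)))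

/-- An inner function. -/
def IsInner (φ : ℂ → ℂ) : Prop :=
  DifferentiableOn ℂ φ (ball (0:ℂ) 1) ∧
  MapsTo φ (ball (0:ℂ) 1) (ball (0:ℂ) 1) ∧
  ∀ᵐ ω ∂circleHaar, Tendsto (fun r : ℝ => ‖φ (r • ω)‖) (𝓝[<] 1) (𝓝 1)

/-- Normalized boundary pairing at radius `r`:
`(2π)⁻¹ ∫₀^{2π} f(r e^{it}) conj (g(r e^{it})) dt`. -/
noncomputable def pairR (f g : ℂ → ℂ) (r : ℝ) : ℂ :=
  (2 * (π : ℂ))⁻¹ *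
    ∫ t in (0:ℝ)..(2 * π),
      f (r * Complex.exp (t * Complex.I)) * conj (g (r * Complex.exp (t * Complex.I)))

/-- Membership in the Hardy space `H²` of the disc: holomorphic with uniformly
bounded quadratic integral means. -/
def MemH2 (f : ℂ → ℂ) : Prop :=
  DifferentiableOn ℂ f (ball (0:ℂ) 1) ∧
    ∃ C : ℝ, ∀ r ∈ Ico (0:ℝ) 1, (pairR f f r).re ≤ C

/-- Membership in the model space `H(φ) = H² ⊖ φH²`: belonging to `H²` and
being orthogonal (in the boundary `L²` pairing) to every element of `φH²`. -/
def MemModel (φ f : ℂ → ℂ) : Prop :=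
  MemH2 f ∧ ∀ g : ℂ → ℂ, MemH2 g →
    Tendsto (fun r => pairR f (fun w => φ w * g w) r) (𝓝[<] (1:ℝ)) (𝓝 0)


/-- The set `Iso(φ)`: finite positive Borel measures `μ` on the unit circle
such that every member `g` of the disc algebra intersected with the model space
`H(φ)` satisfies `∫_𝕋 |g|² dμ = ‖g‖²_{H²}` (the `H²` norm being the limit of
the quadratic integral means of `g`). -/
noncomputable def IsoSet (φ : ℂ → ℂ) :
    Set (MeasureTheory.FiniteMeasure (Metric.sphere (0:ℂ) 1)) :=
  {μ | ∀ g : ℂ → ℂ, ContinuousOn g (closedBall (0:ℂ) 1) →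
    DifferentiableOn ℂ g (ball (0:ℂ) 1) → MemModel φ g →
    ∀ N : ℝ, Tendsto (fun r => (pairR g g r).re) (𝓝[<] (1:ℝ)) (𝓝 N) →
      (∫ ω : Metric.sphere (0:ℂ) 1, ‖g (↑ω)‖ ^ 2 ∂(μ : Measure _)) = N}

open Complex MeasureTheory Metric Set Filter
open scoped Topology ComplexConjugate Real NNReal
open scoped Pointwise

theorem aux_weakDual_sep {X : Type*} [NormedAddCommGroup X] [NormedSpace ℂ X]
    (K : Set (WeakDual ℂ X)) (hK : Convex ℝ K) (hc : IsClosed K) (L : WeakDual ℂ X) (hL : L ∉ K) :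
    ∃ (x : X) (u : ℝ), (∀ M ∈ K, (M x).re < u) ∧ u < (L x).re := by
  have h0 : IsScalarTower ℝ ℂ (WeakDual ℂ X) := inferInstanceAs (IsScalarTower ℝ ℂ (X →L[ℂ] ℂ))
  have h1 : LocallyConvexSpace ℝ (WeakDual ℂ X) :=
    (LinearMap.weakBilin_withSeminorms (topDualPairing ℂ X)).toLocallyConvexSpace
  obtain ⟨f, u, hf, hu⟩ := @RCLike.geometric_hahn_banach_closed_point ℂ (WeakDual ℂ X) _ _ _ K L _ _ _ _ _  h1 hK hc hL
  obtain ⟨x, hx⟩ := LinearMap.dualEmbedding_surjective (topDualPairing ℂ X) f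
  refine ⟨x, u, fun M hM => ?_, ?_⟩
  · have := hf M hM
    rw [← hx] at this
    exact this
  · rw [← hx] at hu
    exact hu

theorem aux_rot (a : ℂ) : ∃ c : ℂ, ‖c‖ = 1 ∧ (c * a).re = ‖a‖ := by
  by_cases h : a = 0
  · exact ⟨1, by simp, by simp [h]⟩
  · have hn : (‖a‖ : ℝ) ≠ 0 := by simpa using h
    refine ⟨conj a / ‖a‖, by simp [hn], ?_⟩
    rw [div_mul_eq_mul_div, ← Complex.normSq_eq_conj_mul_self, Complex.normSq_eq_norm_sq]
    rw [← Complex.ofReal_div, Complex.ofReal_re]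
    field_simp

def auxBall {X : Type*} [NormedAddCommGroup X] [NormedSpace ℂ X]
    (W : Submodule ℂ (StrongDual ℂ X)) : Set (WeakDual ℂ X) :=
  {L | WeakDual.toStrongDual L ∈ W ∧ ‖WeakDual.toStrongDual L‖ ≤ 1}

theorem auxBall_convex {X : Type*} [NormedAddCommGroup X] [NormedSpace ℂ X]
    (W : Submodule ℂ (StrongDual ℂ X)) : Convex ℝ (auxBall W) := by
  intro L hL M hM a b ha hb hab
  refine ⟨?_, ?_⟩
  · have : WeakDual.toStrongDual (a • L + b • M) =
      (a : ℂ) • WeakDual.toStrongDual L + (b : ℂ) • WeakDual.toStrongDual M := by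
      ext x; rfl
    rw [this]
    exact W.add_mem (W.smul_mem _ hL.1) (W.smul_mem _ hM.1)
  · have : WeakDual.toStrongDual (a • L + b • M) =
      a • WeakDual.toStrongDual L + b • WeakDual.toStrongDual M := by
      ext x; rfl
    rw [this]
    have h1 := (convex_closedBall (0 : StrongDual ℂ X) 1) (x := WeakDual.toStrongDual L)
      (by simpa using hL.2) (y := WeakDual.toStrongDual M) (by simpa using hM.2) ha hb hab
    simpa using h1

theorem aux_bipolar {X : Type*} [NormedAddCommGroup X] [NormedSpace ℂ X]
    (W : Submodule ℂ (StrongDual ℂ X)) (hS : IsClosed (auxBall W)) (L : StrongDual ℂ X)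
    (t : ℝ) (ht : 0 < t) (h : ∀ x : X, (∀ M ∈ W, ‖M‖ ≤ 1 → ‖M x‖ ≤ 1) → ‖L x‖ ≤ t) : L ∈ W := by
  by_contra hL
  have ht' : (t : ℂ) ≠ 0 := by exact_mod_cast ht.ne'
  have hn : StrongDual.toWeakDual ((t : ℂ)⁻¹ • L) ∉ auxBall W := by
    rintro ⟨h1, -⟩
    apply hL
    have h2 : ((t : ℂ)⁻¹ • L) ∈ W := h1
    have := W.smul_mem (t : ℂ) h2
    rwa [smul_smul, mul_inv_cancel₀ ht', one_smul] at this
  obtain ⟨x, u, hu, hx⟩ := aux_weakDual_sep _ (auxBall_convex W) hS _ hn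
  have hu0 : 0 < u := by
    have := hu 0 ⟨by simp, by simp⟩
    exact this
  have hM : ∀ M ∈ W, ‖M‖ ≤ 1 → ‖M x‖ ≤ u := by
    intro M hM hM1
    obtain ⟨c, hc, hc'⟩ := aux_rot (M x)
    have := hu (StrongDual.toWeakDual (c • M)) ⟨W.smul_mem _ hM, by
      change ‖c • M‖ ≤ 1
      rw [norm_smul, hc, one_mul]; exact hM1⟩
    have h3 : (c * M x).re < u := this
    rw [hc'] at h3
    exact h3.le
  have h1 := h (((u⁻¹ : ℝ) : ℂ) • x) (by
    intro M hMW hM1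
    have := hM M hMW hM1
    rw [map_smul, norm_smul, Complex.norm_real, Real.norm_of_nonneg (by positivity)]
    field_simp
    exact this)
  rw [map_smul, norm_smul, Complex.norm_real, Real.norm_of_nonneg (by positivity)] at h1
  have h2 : u < ((t : ℂ)⁻¹ * L x).re := hx
  rw [← Complex.ofReal_inv, Complex.re_ofReal_mul] at h2
  have h3 := Complex.re_le_norm (L x)
  have h4 : ‖L x‖ ≤ t * u := by
    rw [inv_mul_le_iff₀ hu0] at h1; linarith
  have h5 : u * t < (L x).re := by
    rw [inv_mul_eq_div, lt_div_iff₀ ht] at h2; exact h2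
  linarith

theorem aux_ks_step {X : Type*} [NormedAddCommGroup X] [NormedSpace ℂ X]
    (W : Submodule ℂ (StrongDual ℂ X)) (hS : IsClosed (auxBall W)) (g : X) (s : ℝ) (hs : 0 < s)
    (hg : ∀ M ∈ W, ‖M‖ ≤ 1 → ‖M g‖ ≤ s) :
    ∃ c : X, ‖c‖ ≤ 2 * s ∧ ∀ M ∈ W, ‖M‖ ≤ 1 → ‖M (g - c)‖ ≤ s / 2 := by
  by_contra hcon
  push Not at hcon
  set P : Set X := {x | ∀ M ∈ W, ‖M‖ ≤ 1 → ‖M x‖ ≤ s / 2} with hP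
  have hPc : Convex ℝ P := by
    intro x hx y hy a b ha hb hab M hM hM1
    have h1 := hx M hM hM1
    have h2 := hy M hM hM1
    have : M (a • x + b • y) = (a : ℂ) * M x + (b : ℂ) * M y := by
      rw [map_add]
      have e1 : ∀ (r : ℝ) (z : X), M (r • z) = (r : ℂ) * M z := by
        intro r z
        rw [← Complex.coe_smul r z, map_smul, smul_eq_mul]
      rw [e1, e1]
    rw [this]
    calc _ ≤ ‖(a : ℂ) * M x‖ + ‖(b : ℂ) * M y‖ := norm_add_le _ _
      _ = a * ‖M x‖ + b * ‖M y‖ := by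
        rw [norm_mul, norm_mul, Complex.norm_real, Complex.norm_real, Real.norm_of_nonneg ha,
          Real.norm_of_nonneg hb]
      _ ≤ a * (s / 2) + b * (s / 2) := by gcongr
      _ = s / 2 := by rw [← add_mul, hab, one_mul]
  have hgn : g ∉ ball (0 : X) (2 * s) + P := by
    rintro ⟨c, hc, p, hp, hcp⟩
    have hc' : ‖c‖ < 2 * s := by simpa using hc
    obtain ⟨M, hM, hM1, h⟩ := hcon c hc'.le
    have : g - c = p := by rw [← hcp]; simp
    rw [this] at h
    exact absurd (hp M hM hM1) (not_le.2 h)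
  obtain ⟨L, hL⟩ := RCLike.geometric_hahn_banach_open_point (𝕜 := ℂ)
    ((convex_ball (0 : X) (2 * s)).add hPc) (isOpen_ball.add_right) hgn
  have hL' : ∀ a ∈ ball (0 : X) (2 * s) + P, (L a).re < (L g).re := hL
  have hP0 : (0 : X) ∈ P := by intro M _ _; simp; positivity
  have hB0 : (0 : X) ∈ ball (0 : X) (2 * s) := by simpa using hs
  have hR : 0 < (L g).re := by
    have := hL' 0 ⟨0, hB0, 0, hP0, by simp⟩
    simpa using this
  set R := (L g).re with hRdef
  have hball : ∀ c ∈ closedBall (0 : X) (3 / 2 * s), ‖L c‖ ≤ R := by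
    intro c hc
    obtain ⟨e, he, he'⟩ := aux_rot (L c)
    have hc' : ‖c‖ ≤ 3 / 2 * s := by simpa using hc
    have := hL' (e • c) ⟨e • c, by simp [norm_smul, he]; linarith, 0, hP0, by simp⟩
    rw [map_smul, smul_eq_mul, he'] at this
    exact this.le
  have hLn := ContinuousLinearMap.opNorm_bound_of_ball_bound (by positivity : 0 < 3 / 2 * s) R L hball
  have hLW : L ∈ W := by
    apply aux_bipolar W hS L (2 / s * R) (by positivity)
    intro x hx
    obtain ⟨e, he, he'⟩ := aux_rot (L x)
    have := hL' (((s / 2 : ℝ) : ℂ) • (e • x)) ⟨0, hB0, ((s / 2 : ℝ) : ℂ) • (e • x), by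
      intro M hM hM1
      have := hx M hM hM1
      rw [map_smul, map_smul, norm_smul, norm_smul, he, Complex.norm_real,
        Real.norm_of_nonneg (by positivity), one_mul]
      nlinarith, by simp⟩
    rw [map_smul, map_smul, smul_eq_mul, smul_eq_mul, Complex.re_ofReal_mul, he'] at this
    rw [div_mul_eq_mul_div, le_div_iff₀ hs]
    linarith
  have hL0 : 0 < ‖L‖ := by
    rw [norm_pos_iff]
    rintro rfl
    simp [hRdef] at hR
  have h1 := hg (((‖L‖⁻¹ : ℝ) : ℂ) • L) (W.smul_mem _ hLW) (by
    rw [norm_smul, Complex.norm_real, Real.norm_of_nonneg (by positivity)]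
    rw [inv_mul_cancel₀ hL0.ne'])
  rw [_root_.smul_apply, norm_smul, Complex.norm_real,
    Real.norm_of_nonneg (by positivity), inv_mul_le_iff₀ hL0] at h1
  have h2 := Complex.re_le_norm (L g)
  rw [le_div_iff₀ (by positivity)] at hLn
  nlinarith

/-- A form of the Krein–Smulian theorem. -/
theorem aux_ks {X : Type*} [NormedAddCommGroup X] [NormedSpace ℂ X] [CompleteSpace X]
    (W : Submodule ℂ (StrongDual ℂ X)) (hS : IsClosed (auxBall W)) (L : StrongDual ℂ X)
    (hL : L ∉ W) : ∃ g : X, (∀ M ∈ W, M g = 0) ∧ L g ≠ 0 := by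
  have h0 : ∃ g₀ : X, (∀ M ∈ W, ‖M‖ ≤ 1 → ‖M g₀‖ ≤ 1) ∧ 4 * ‖L‖ + 1 < ‖L g₀‖ := by
    by_contra hcon
    push Not at hcon
    exact hL (aux_bipolar W hS L (4 * ‖L‖ + 1) (by positivity) hcon)
  obtain ⟨g₀, hg₀, hLg⟩ := h0
  have step : ∀ (n : ℕ) (g : X), (∀ M ∈ W, ‖M‖ ≤ 1 → ‖M g‖ ≤ (1 / 2 : ℝ) ^ n) →
      ∃ g' : X, ‖g' - g‖ ≤ 2 * (1 / 2 : ℝ) ^ n ∧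
        (∀ M ∈ W, ‖M‖ ≤ 1 → ‖M g'‖ ≤ (1 / 2 : ℝ) ^ (n + 1)) := by
    intro n g hg
    obtain ⟨c, hc, hc'⟩ := aux_ks_step W hS g _ (by positivity : (0 : ℝ) < (1 / 2) ^ n) hg
    refine ⟨g - c, by simpa using hc, fun M hM hM1 => (hc' M hM hM1).trans_eq ?_⟩
    rw [pow_succ]; ring
  choose! nx hnx using step
  let G : ℕ → X := fun n => Nat.rec g₀ (fun k g => nx k g) n
  have hG : ∀ n, ∀ M ∈ W, ‖M‖ ≤ 1 → ‖M (G n)‖ ≤ (1 / 2 : ℝ) ^ n := by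
    intro n
    induction n with
    | zero => simpa [G] using hg₀
    | succ k ih => exact (hnx k (G k) ih).2
  have hd : ∀ n, dist (G n) (G (n + 1)) ≤ 4 / 2 / 2 ^ n := by
    intro n
    rw [dist_comm, dist_eq_norm]
    refine (hnx n (G n) (hG n)).1.trans_eq ?_
    rw [one_div, inv_pow]; ring
  have hcau := cauchySeq_of_le_geometric_two hd
  obtain ⟨g, hg⟩ := cauchySeq_tendsto_of_complete hcau
  have hdist := dist_le_of_le_geometric_two_of_tendsto₀ hd hg
  refine ⟨g, fun M hM => ?_, ?_⟩
  · have key : ∀ M ∈ W, ‖M‖ ≤ 1 → M g = 0 := by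
      intro M hM hM1
      have h1 : Tendsto (fun n => M (G n)) atTop (𝓝 (M g)) := (M.continuous.tendsto g).comp hg
      have h2 : Tendsto (fun n => M (G n)) atTop (𝓝 0) :=
        squeeze_zero_norm (fun n => hG n M hM hM1)
          (tendsto_pow_atTop_nhds_zero_of_lt_one (by norm_num) (by norm_num))
      exact tendsto_nhds_unique h1 h2
    by_cases hM0 : M = 0
    · simp [hM0]
    have hMn : 0 < ‖M‖ := norm_pos_iff.2 hM0
    have := key (((‖M‖⁻¹ : ℝ) : ℂ) • M) (W.smul_mem _ hM) (by
      rw [norm_smul, Complex.norm_real, Real.norm_of_nonneg (by positivity),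
        inv_mul_cancel₀ hMn.ne'])
    simpa [hM0] using this
  · intro hz
    have h1 : ‖L (G 0 - g)‖ ≤ ‖L‖ * 4 := by
      refine (L.le_opNorm _).trans ?_
      gcongr
      rw [← dist_eq_norm]; exact hdist
    rw [map_sub, hz, sub_zero] at h1
    have h2 : ‖L g₀‖ ≤ ‖L‖ * 4 := h1
    linarith

theorem aux_cmem {r : ℝ} (h0 : 0 ≤ r) (h1 : r < 1) (t : ℝ) :
    (r : ℂ) * Complex.exp (t * Complex.I) ∈ ball (0 : ℂ) 1 := by
  simp [Complex.norm_exp_ofReal_mul_I, abs_of_nonneg h0, h1]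

theorem aux_cont_circle {f : ℂ → ℂ} (hf : ContinuousOn f (ball 0 1)) {r : ℝ} (h0 : 0 ≤ r)
    (h1 : r < 1) : Continuous (fun t : ℝ => f ((r : ℂ) * Complex.exp (t * Complex.I))) :=
  hf.comp_continuous (by fun_prop) (fun t => aux_cmem h0 h1 t)

theorem aux_cauchy {f : ℂ → ℂ} (hf : DifferentiableOn ℂ f (ball 0 1)) {r : ℝ} {w : ℂ}
    (h1 : r < 1) (hw : ‖w‖ < r) :
    (2 * (π : ℂ))⁻¹ * ∫ t in (0:ℝ)..(2 * π), ((r : ℂ) * Complex.exp (t * Complex.I) /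
      ((r : ℂ) * Complex.exp (t * Complex.I) - w)) * f ((r : ℂ) * Complex.exp (t * Complex.I))
      = f w := by
  have hr : 0 < r := (norm_nonneg w).trans_lt hw
  have hd : DiffContOnCl ℂ f (ball 0 |r|) := by
    apply DifferentiableOn.diffContOnCl
    rw [closure_ball _ (by simpa using hr.ne')]
    exact hf.mono (closedBall_subset_ball (by rwa [abs_of_pos hr]))
  have := hd.circleAverage_smul_div (w := w) (by simpa [abs_of_pos hr] using hw)
  rw [Real.circleAverage_def] at this
  simp only [circleMap, sub_zero, zero_add, smul_eq_mul, Complex.real_smul] at this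
  rw [← this]
  push_cast
  rfl

theorem aux_max_pow {φ : ℂ → ℂ} (hφ : IsInner φ) {u : ℂ → ℂ}
    (hu : DifferentiableOn ℂ u (ball 0 1)) {M : ℝ} (hM : ∀ z ∈ ball (0 : ℂ) 1, ‖u z‖ ≤ M)
    (h1 : ∀ z ∈ ball (0 : ℂ) 1, ‖φ z * u z‖ ≤ 1) (n : ℕ) (z : ℂ) (hz : z ∈ ball (0 : ℂ) 1) :
    ‖u z‖ ^ n ≤ 2 / (1 - ‖z‖) := by
  have hz' : ‖z‖ < 1 := by simpa using hz
  obtain ⟨hd, hmap, hbd⟩ := hφ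
  have hM0 : 0 ≤ M := (norm_nonneg _).trans (hM z hz)
  -- boundary limit
  have hae : ∀ᵐ t : ℝ ∂(volume.restrict (Ioc (0:ℝ) (2 * π))),
      Tendsto (fun r : ℝ => ‖φ ((r : ℂ) * Complex.exp (t * Complex.I))‖) (𝓝[<] 1) (𝓝 1) := by
    have h2 : ∀ᵐ ω ∂(Measure.map (fun t : ℝ => Complex.exp (t * Complex.I))
      (volume.restrict (Ioc (0:ℝ) (2 * π)))),
      Tendsto (fun r : ℝ => ‖φ (r • ω)‖) (𝓝[<] 1) (𝓝 1) := by
      rw [circleHaar, Measure.ae_ennreal_smul_measure_iff] at hbd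
      · exact hbd
      · simp [Real.pi_pos]
    have h3 := ae_of_ae_map (by fun_prop) h2
    simpa only [Complex.real_smul] using h3
  have hev : ∀ᶠ r : ℝ in 𝓝[<] 1, (1 + ‖z‖) / 2 < r ∧ r < 1 := by
    have : Ioo ((1 + ‖z‖) / 2) 1 ∈ 𝓝[<] (1 : ℝ) := Ioo_mem_nhdsLT (by linarith)
    exact this
  have hlim : Tendsto (fun r : ℝ => ∫ t in Ioc (0:ℝ) (2 * π),
      (1 + M ^ n * (1 - ‖φ ((r : ℂ) * Complex.exp (t * Complex.I))‖ ^ n))) (𝓝[<] 1)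
      (𝓝 (∫ t in Ioc (0:ℝ) (2 * π), (1 : ℝ))) := by
    apply tendsto_integral_filter_of_dominated_convergence (fun _ => 1 + M ^ n)
    · filter_upwards [hev] with r hr
      have hr0 : 0 ≤ r := by linarith [norm_nonneg z]
      have := aux_cont_circle hd.continuousOn hr0 hr.2
      exact (continuous_const.add (continuous_const.mul
        (continuous_const.sub (this.norm.pow n)))).aestronglyMeasurable
    · filter_upwards [hev] with r hr
      refine ae_of_all _ fun t => ?_
      have hr0 : 0 ≤ r := by linarith [norm_nonneg z]
      have hb : ‖φ ((r : ℂ) * Complex.exp (t * Complex.I))‖ < 1 := by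
        simpa using hmap (aux_cmem hr0 hr.2 t)
      have hb1 := pow_le_one₀ (n := n) (norm_nonneg _) hb.le
      have hb0 : 0 ≤ ‖φ ((r : ℂ) * Complex.exp (t * Complex.I))‖ ^ n := by positivity
      have hMn : 0 ≤ M ^ n := by positivity
      rw [Real.norm_of_nonneg (by nlinarith)]
      nlinarith
    · exact integrable_const _
    · filter_upwards [hae] with t ht
      have := ((tendsto_const_nhds (x := (1:ℝ))).sub (ht.pow n)).const_mul (M ^ n)
      have := (tendsto_const_nhds (x := (1:ℝ))).add this
      simpa using this
  have hle : ∀ᶠ r : ℝ in 𝓝[<] 1, ‖u z‖ ^ n ≤ (2 * π)⁻¹ * (2 / (1 - ‖z‖) *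
      ∫ t in Ioc (0:ℝ) (2 * π),
      (1 + M ^ n * (1 - ‖φ ((r : ℂ) * Complex.exp (t * Complex.I))‖ ^ n))) := by
    filter_upwards [hev] with r hr
    have hr0 : 0 ≤ r := by linarith [norm_nonneg z]
    have hc := aux_cauchy (hu.pow n) hr.2 (by linarith : ‖z‖ < r)
    simp only [Pi.pow_apply] at hc
    rw [← norm_pow, ← hc, norm_mul]
    have e1 : ‖(2 * (π : ℂ))⁻¹‖ = (2 * π)⁻¹ := by
      rw [norm_inv, norm_mul, Complex.norm_real, Real.norm_of_nonneg Real.pi_pos.le]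
      simp
    rw [e1]
    gcongr
    rw [← integral_const_mul]
    rw [intervalIntegral.integral_of_le (by positivity)]
    have hcφ := aux_cont_circle hd.continuousOn hr0 hr.2
    apply norm_integral_le_of_norm_le
    · have : Continuous (fun a : ℝ => 2 / (1 - ‖z‖) * (1 + M ^ n *
        (1 - ‖φ ((r : ℂ) * Complex.exp (a * Complex.I))‖ ^ n))) :=
        continuous_const.mul (continuous_const.add (continuous_const.mul
          (continuous_const.sub (hcφ.norm.pow n))))
      exact this.integrableOn_Ioc
    · refine ae_of_all _ fun t => ?_
      set w := (r : ℂ) * Complex.exp (t * Complex.I) with hw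
      have hwb : w ∈ ball (0 : ℂ) 1 := aux_cmem hr0 hr.2 t
      have hwn : ‖w‖ = r := by
        simp [hw, Complex.norm_exp_ofReal_mul_I, abs_of_nonneg hr0]
      rw [norm_mul, norm_div, norm_pow, hwn]
      have hwz : (1 - ‖z‖) / 2 ≤ ‖w - z‖ := by
        have := norm_sub_norm_le w z
        rw [hwn] at this; linarith
      have hwz' : r / ‖w - z‖ ≤ 2 / (1 - ‖z‖) := by
        have h1z : 0 < 1 - ‖z‖ := by linarith
        rw [div_le_div_iff₀ (by linarith) h1z]
        nlinarith [hr.2]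
      have hb : ‖φ w‖ < 1 := by simpa using hmap hwb
      have hb1 := pow_le_one₀ (n := n) (norm_nonneg _) hb.le
      have hk : ‖u w‖ ^ n ≤ 1 + M ^ n * (1 - ‖φ w‖ ^ n) := by
        have h5 : ‖φ w‖ ^ n * ‖u w‖ ^ n ≤ 1 := by
          rw [← mul_pow, ← norm_mul]
          exact pow_le_one₀ (norm_nonneg _) (h1 w hwb)
        have h6 : ‖u w‖ ^ n ≤ M ^ n := pow_le_pow_left₀ (norm_nonneg _) (hM w hwb) n
        nlinarith
      gcongr
  have hfin := ge_of_tendsto ((hlim.const_mul (2 / (1 - ‖z‖))).const_mul ((2 * π)⁻¹)) hle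
  refine hfin.trans_eq ?_
  have : ∫ t in Ioc (0:ℝ) (2 * π), (1 : ℝ) = 2 * π := by
    rw [← intervalIntegral.integral_of_le (by positivity)]; simp
  rw [this]
  field_simp

theorem aux_max {φ : ℂ → ℂ} (hφ : IsInner φ) {u : ℂ → ℂ}
    (hu : DifferentiableOn ℂ u (ball 0 1)) {M : ℝ} (hM : ∀ z ∈ ball (0 : ℂ) 1, ‖u z‖ ≤ M)
    (h1 : ∀ z ∈ ball (0 : ℂ) 1, ‖φ z * u z‖ ≤ 1) (z : ℂ) (hz : z ∈ ball (0 : ℂ) 1) :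
    ‖u z‖ ≤ 1 := by
  by_contra hcon
  push Not at hcon
  obtain ⟨n, hn⟩ := pow_unbounded_of_one_lt (2 / (1 - ‖z‖)) hcon
  exact absurd (aux_max_pow hφ hu hM h1 n z hz) (not_le.2 hn)

def AuxPos (G : ℂ → ℂ) : Prop :=
  DifferentiableOn ℂ G (ball 0 1) ∧ ∀ z ∈ ball (0 : ℂ) 1, 0 ≤ (G z).re

theorem aux_one_le {a : ℂ} (ha : 0 ≤ a.re) : 1 ≤ ‖1 + a‖ := by
  have := Complex.re_le_norm (1 + a)
  simp at this; linarith

theorem aux_eps {a : ℂ} (ha : 0 ≤ a.re) {e : ℝ} (he : 0 < e) (he1 : e ≤ 1) :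
    e * ‖1 + a‖ ≤ ‖1 + e * a‖ := by
  have h : ‖((e : ℂ) * (1 + a))‖ ≤ ‖1 + e * a‖ := by
    rw [← sq_le_sq₀ (norm_nonneg _) (norm_nonneg _), Complex.sq_norm, Complex.sq_norm,
      Complex.normSq_apply, Complex.normSq_apply]
    simp
    nlinarith [mul_nonneg he.le ha]
  rwa [norm_mul, Complex.norm_real, Real.norm_of_nonneg he.le] at h

theorem aux_smirnov {φ : ℂ → ℂ} (hφ : IsInner φ) (l : List (ℂ → ℂ)) :
    (∀ G ∈ l, AuxPos G) → ∀ (q : ℂ → ℂ) (M : ℝ), DifferentiableOn ℂ q (ball 0 1) →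
    (∀ z ∈ ball (0 : ℂ) 1, ‖q z‖ ≤ M * (l.map (fun G => ‖1 + G z‖)).prod) →
    (∀ z ∈ ball (0 : ℂ) 1, ‖φ z * q z‖ ≤ 1) → ∀ z ∈ ball (0 : ℂ) 1, ‖q z‖ ≤ 1 := by
  induction l with
  | nil =>
    intro _ q M hq hM h1
    exact aux_max hφ hq (M := M) (by simpa using hM) h1
  | cons G l ih =>
    intro hl q M hq hM h1 z hz
    have hG : AuxPos G := hl G (by simp)
    have key : ∀ e : ℝ, 0 < e → e ≤ 1 → ‖q z‖ ≤ ‖1 + e * G z‖ := by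
      intro e he he1
      have hge : ∀ w ∈ ball (0 : ℂ) 1, 1 ≤ ‖1 + e * G w‖ := by
        intro w hw
        apply aux_one_le
        rw [Complex.re_ofReal_mul]
        exact mul_nonneg he.le (hG.2 w hw)
      have := ih (fun H hH => hl H (by simp [hH])) (fun w => q w / (1 + e * G w)) (M / e) ?_ ?_ ?_ z hz
      · have h3 := hge z hz
        rw [norm_div, div_le_one (by linarith)] at this
        exact this
      · apply hq.div ((differentiableOn_const _).add ((differentiableOn_const _).mul hG.1))
        intro w hw h0
        have := hge w hw
        have h0' : 1 + e * G w = 0 := h0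
        rw [h0'] at this; simp at this; linarith
      · intro w hw
        have h3 := hge w hw
        have h4 := aux_eps (hG.2 w hw) he he1
        have h5 := hM w hw
        simp only [List.map_cons, List.prod_cons] at h5
        rw [norm_div, div_le_iff₀ (by linarith)]
        refine h5.trans ?_
        have hP : 0 < (l.map (fun G => ‖1 + G w‖)).prod := by
          apply List.prod_pos
          intro a ha
          obtain ⟨H, hH, rfl⟩ := List.mem_map.1 ha
          have := aux_one_le ((hl H (by simp [hH])).2 w hw)
          linarith
        have hM0 : 0 ≤ M := by
          by_contra hneg
          have h6 := aux_one_le (hG.2 w hw)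
          have h7 := norm_nonneg (q w)
          have : M * (‖1 + G w‖ * (l.map (fun G => ‖1 + G w‖)).prod) < 0 :=
            mul_neg_of_neg_of_pos (by linarith) (by positivity)
          linarith
        calc M * (‖1 + G w‖ * (l.map (fun G => ‖1 + G w‖)).prod)
            = M / e * (l.map (fun G => ‖1 + G w‖)).prod * (e * ‖1 + G w‖) := by
              field_simp
          _ ≤ _ := by gcongr
      · intro w hw
        have h3 := hge w hw
        rw [mul_div_assoc', norm_div, div_le_one (by linarith)]
        exact (h1 w hw).trans h3
    have hcont : Tendsto (fun e : ℝ => ‖1 + e * G z‖) (𝓝[>] 0) (𝓝 ‖1 + ((0 : ℝ) : ℂ) * G z‖) := by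
      have : Continuous (fun e : ℝ => ‖1 + e * G z‖) := by fun_prop
      exact (this.tendsto 0).mono_left nhdsWithin_le_nhds
    have := ge_of_tendsto hcont (by
      filter_upwards [Ioc_mem_nhdsGT (zero_lt_one' ℝ)] with e he
      exact key e he.1 he.2)
    simpa using this

noncomputable def auxProj (w : ℂ) : closedBall (0 : ℂ) 1 :=
  ⟨w / ((max 1 ‖w‖ : ℝ) : ℂ), by
    have h : 0 < max 1 ‖w‖ := lt_max_of_lt_left one_pos
    rw [mem_closedBall_zero_iff, norm_div, Complex.norm_real, Real.norm_of_nonneg h.le,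
      div_le_one h]
    exact le_max_right _ _⟩

theorem auxProj_cont : Continuous auxProj := by
  apply Continuous.subtype_mk
  apply Continuous.div continuous_id (by fun_prop)
  intro w
  have h : 0 < max 1 ‖w‖ := lt_max_of_lt_left one_pos
  exact_mod_cast h.ne'

theorem auxProj_eq {w : ℂ} (hw : ‖w‖ ≤ 1) : (auxProj w : ℂ) = w := by
  simp [auxProj, max_eq_left hw]

noncomputable def auxExt (x : C(closedBall (0 : ℂ) 1, ℂ)) (w : ℂ) : ℂ := x (auxProj w)

theorem auxExt_cont (x : C(closedBall (0 : ℂ) 1, ℂ)) : Continuous (auxExt x) :=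
  x.continuous.comp auxProj_cont

theorem auxExt_norm_le (x : C(closedBall (0 : ℂ) 1, ℂ)) (w : ℂ) : ‖auxExt x w‖ ≤ ‖x‖ :=
  x.norm_coe_le_norm _

theorem auxExt_coe (x : C(closedBall (0 : ℂ) 1, ℂ)) (w : closedBall (0 : ℂ) 1) :
    auxExt x w = x w := by
  unfold auxExt
  congr 1
  exact Subtype.ext (auxProj_eq (mem_closedBall_zero_iff.1 w.2))

/-- The disc algebra as a subspace. -/
noncomputable def auxA : Submodule ℂ C(closedBall (0 : ℂ) 1, ℂ) where
  carrier := {x | DifferentiableOn ℂ (auxExt x) (ball 0 1)}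
  add_mem' := fun hx hy => DifferentiableOn.add hx hy
  zero_mem' := differentiableOn_const 0
  smul_mem' := fun c _ hx => DifferentiableOn.const_smul hx c

theorem auxA_closed : IsClosed (auxA : Set C(closedBall (0 : ℂ) 1, ℂ)) := by
  apply IsSeqClosed.isClosed
  intro s x hs hx
  have hu : TendstoUniformly (fun n => auxExt (s n)) (auxExt x) atTop := by
    have h1 : TendstoUniformly (fun n => ⇑(s n)) (⇑x) atTop :=
      ContinuousMap.tendsto_iff_tendstoUniformly.1 hx
    exact h1.comp auxProj
  have := hu.tendstoUniformlyOn (s := ball (0 : ℂ) 1)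
  exact this.tendstoLocallyUniformlyOn.differentiableOn (Eventually.of_forall hs) isOpen_ball

noncomputable instance auxA_complete : CompleteSpace auxA :=
  auxA_closed.completeSpace_coe

noncomputable def auxMk (f : ℂ → ℂ) (hc : ContinuousOn f (closedBall 0 1))
    (hd : DifferentiableOn ℂ f (ball 0 1)) : auxA :=
  ⟨⟨fun w => f w, hc.domRestrict⟩, by
    refine hd.congr fun w hw => ?_
    have : ‖w‖ ≤ 1 := by have := mem_ball_zero_iff.1 hw; exact this.le
    change f (auxProj w) = f w
    rw [auxProj_eq this]⟩

theorem auxMk_ext (f : ℂ → ℂ) (hc : ContinuousOn f (closedBall 0 1))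
    (hd : DifferentiableOn ℂ f (ball 0 1)) {w : ℂ} (hw : ‖w‖ ≤ 1) :
    auxExt (auxMk f hc hd : C(closedBall (0 : ℂ) 1, ℂ)) w = f w := by
  change f (auxProj w) = f w
  rw [auxProj_eq hw]

theorem aux_den_ne {z w : ℂ} (hz : ‖z‖ < 1) (hw : ‖w‖ ≤ 1) : 1 - z * w ≠ 0 := by
  intro h
  have h1 : z * w = 1 := (sub_eq_zero.1 h).symm
  have h2 : ‖z‖ * ‖w‖ = 1 := by rw [← norm_mul, h1, norm_one]
  nlinarith [norm_nonneg z, norm_nonneg w]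

noncomputable def auxK (z : ball (0 : ℂ) 1) : auxA :=
  auxMk (fun w => (1 - conj (z : ℂ) * w)⁻¹)
    (ContinuousOn.inv₀ (by fun_prop) fun w hw =>
      aux_den_ne (by rw [RCLike.norm_conj]; exact mem_ball_zero_iff.1 z.2) (by simpa using hw))
    (DifferentiableOn.inv (by fun_prop) fun w hw =>
      aux_den_ne (by rw [RCLike.norm_conj]; exact mem_ball_zero_iff.1 z.2) (by have := mem_ball_zero_iff.1 hw; exact this.le))

theorem auxK_ext (z : ball (0 : ℂ) 1) {w : ℂ} (hw : ‖w‖ ≤ 1) :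
    auxExt (auxK z : C(closedBall (0 : ℂ) 1, ℂ)) w = (1 - conj (z : ℂ) * w)⁻¹ :=
  auxMk_ext _ _ _ hw

theorem aux_integrable (μ : FiniteMeasure (sphere (0 : ℂ) 1)) {f : sphere (0 : ℂ) 1 → ℂ}
    (hf : Continuous f) : Integrable f (μ : Measure (sphere (0 : ℂ) 1)) :=
  (BoundedContinuousFunction.mkOfCompact ⟨f, hf⟩).integrable _

noncomputable def auxLam (μ : FiniteMeasure (sphere (0 : ℂ) 1)) : StrongDual ℂ auxA :=
  LinearMap.mkContinuous
    { toFun := fun x => ∫ ω, auxExt x ω ∂(μ : Measure (sphere (0 : ℂ) 1))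
      map_add' := fun x y => integral_add
        (aux_integrable μ ((auxExt_cont x).comp continuous_subtype_val))
        (aux_integrable μ ((auxExt_cont y).comp continuous_subtype_val))
      map_smul' := fun c x => integral_smul c (fun ω : sphere (0 : ℂ) 1 => auxExt x ω) }
    ((μ : Measure (sphere (0 : ℂ) 1)).real univ) (by
      intro x
      rw [mul_comm]
      exact norm_integral_le_of_norm_le_const (ae_of_all _ fun ω => auxExt_norm_le _ _))

theorem auxLam_apply (μ : FiniteMeasure (sphere (0 : ℂ) 1)) (x : auxA) :
    auxLam μ x = ∫ ω, auxExt x ω ∂(μ : Measure (sphere (0 : ℂ) 1)) := rfl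

theorem aux_cont_integral {f : sphere (0 : ℂ) 1 → ℂ} (hf : Continuous f) :
    Continuous (fun μ : FiniteMeasure (sphere (0 : ℂ) 1) =>
      ∫ ω, f ω ∂(μ : Measure (sphere (0 : ℂ) 1))) := by
  rw [continuous_iff_continuousAt]
  intro μ
  exact (FiniteMeasure.tendsto_iff_forall_integral_rclike_tendsto ℂ).1 tendsto_id
    (BoundedContinuousFunction.mkOfCompact ⟨f, hf⟩)

theorem auxLam_add (μ ν : FiniteMeasure (sphere (0 : ℂ) 1)) :
    auxLam (μ + ν) = auxLam μ + auxLam ν := by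
  ext x
  simp only [auxLam_apply, _root_.add_apply, FiniteMeasure.toMeasure_add]
  exact integral_add_measure (aux_integrable μ ((auxExt_cont x).comp continuous_subtype_val))
    (aux_integrable ν ((auxExt_cont x).comp continuous_subtype_val))

theorem auxLam_smul (a : ℝ≥0) (μ : FiniteMeasure (sphere (0 : ℂ) 1)) :
    auxLam (a • μ) = (a : ℝ) • auxLam μ := by
  ext x
  simp only [auxLam_apply, _root_.smul_apply, FiniteMeasure.toMeasure_smul]
  exact integral_smul_nnreal_measure _ a

noncomputable def auxPsi (μ : Fin 4 → FiniteMeasure (sphere (0 : ℂ) 1)) : StrongDual ℂ auxA :=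
  ∑ j : Fin 4, (I ^ (j : ℕ)) • auxLam (μ j)

theorem auxPsi_apply (μ : Fin 4 → FiniteMeasure (sphere (0 : ℂ) 1)) (x : auxA) :
    auxPsi μ x = ∑ j : Fin 4, (I ^ (j : ℕ)) * auxLam (μ j) x := by
  simp [auxPsi, sum_apply]

theorem auxPsi_cont : Continuous (fun μ => StrongDual.toWeakDual (auxPsi μ)) := by
  apply WeakDual.continuous_of_continuous_eval
  intro x
  have : ∀ μ, (StrongDual.toWeakDual (auxPsi μ)) x = ∑ j : Fin 4, (I ^ (j : ℕ)) * auxLam (μ j) x :=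
    fun μ => auxPsi_apply μ x
  simp only [this]
  apply continuous_finsetSum
  intro j _
  apply continuous_const.mul
  exact (aux_cont_integral ((auxExt_cont x).comp continuous_subtype_val)).comp (continuous_apply j)

def auxP : Set (Fin 4 → FiniteMeasure (sphere (0 : ℂ) 1)) := {μ | ∀ j, (μ j).mass ≤ 1}

theorem auxP_compact : IsCompact auxP := by
  have h := isCompact_univ_pi (fun _ : Fin 4 =>
    isCompact_setOfPred_finiteMeasure_le_of_compactSpace (sphere (0 : ℂ) 1) 1)
  convert h using 1
  ext μ
  simp [auxP, Set.mem_pi]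

theorem aux_exists_max (x : auxA) : ∃ ω : sphere (0 : ℂ) 1, ‖x‖ ≤ ‖auxExt x ω‖ := by
  have hd : DiffContOnCl ℂ (auxExt x) (ball (0 : ℂ) 1) := ⟨x.2, (auxExt_cont _).continuousOn⟩
  obtain ⟨z, hz, hmax⟩ := Complex.exists_mem_frontier_isMaxOn_norm isBounded_ball
    ⟨0, by simp⟩ hd
  rw [frontier_ball _ one_ne_zero] at hz
  refine ⟨⟨z, hz⟩, ?_⟩
  change ‖(x : C(closedBall (0 : ℂ) 1, ℂ))‖ ≤ _
  rw [ContinuousMap.norm_le _ (norm_nonneg _)]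
  intro w
  rw [closure_ball _ one_ne_zero] at hmax
  have := hmax w.2
  simp only [Set.mem_ofPred_eq, Function.comp_apply] at this
  rw [auxExt_coe] at this
  exact this

theorem aux_mass_conv {μ ν : FiniteMeasure (sphere (0 : ℂ) 1)} {a b : ℝ≥0} (hab : a + b = 1)
    (h1 : μ.mass ≤ 1) (h2 : ν.mass ≤ 1) : (a • μ + b • ν).mass ≤ 1 := by
  have e : (a • μ + b • ν).mass = a * μ.mass + b * ν.mass := by
    change (a • μ + b • ν) univ = a * μ univ + b * ν univ
    rw [FiniteMeasure.coeFn_add, Pi.add_apply, FiniteMeasure.coeFn_smul,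
      FiniteMeasure.coeFn_smul, Pi.smul_apply, Pi.smul_apply, smul_eq_mul, smul_eq_mul]
  rw [e, ← hab]
  exact add_le_add (mul_le_of_le_one_right' h1) (mul_le_of_le_one_right' h2)

theorem auxPsi_conv (μ ν : Fin 4 → FiniteMeasure (sphere (0 : ℂ) 1)) (a b : ℝ≥0) :
    auxPsi (fun j => a • μ j + b • ν j) = (a : ℝ) • auxPsi μ + (b : ℝ) • auxPsi ν := by
  simp only [auxPsi, Finset.smul_sum, ← Finset.sum_add_distrib]
  refine Finset.sum_congr rfl fun j _ => ?_
  rw [auxLam_add, auxLam_smul, auxLam_smul, smul_add, smul_comm (I ^ (j : ℕ)) (a : ℝ),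
    smul_comm (I ^ (j : ℕ)) (b : ℝ)]

theorem aux_sel (x : auxA) (ω : sphere (0 : ℂ) 1) (c : ℂ) :
    ∃ ν : FiniteMeasure (sphere (0 : ℂ) 1), ν.mass ≤ 1 ∧
      (c * auxLam ν x).re = max 0 (c * auxExt x ω).re := by
  by_cases h : 0 ≤ (c * auxExt x ω).re
  · obtain ⟨δ, hδ⟩ : ∃ δ : FiniteMeasure (sphere (0 : ℂ) 1),
        (δ : Measure (sphere (0 : ℂ) 1)) = Measure.dirac ω := ⟨⟨Measure.dirac ω, inferInstance⟩, rfl⟩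
    refine ⟨δ, ?_, ?_⟩
    · rw [← ENNReal.coe_le_coe, FiniteMeasure.ennreal_mass, hδ]
      simp
    · rw [max_eq_right h, auxLam_apply, hδ]
      simp
  · refine ⟨0, by simp, ?_⟩
    rw [max_eq_left (not_le.1 h).le, auxLam_apply]
    simp

theorem aux_decomp (L : StrongDual ℂ auxA) (hL : ‖L‖ ≤ 1) :
    ∃ μ ∈ auxP, auxPsi μ = L := by
  by_contra hcon
  push Not at hcon
  set K : Set (WeakDual ℂ auxA) := (fun μ => StrongDual.toWeakDual (auxPsi μ)) '' auxP with hK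
  have hKc : IsCompact K := auxP_compact.image auxPsi_cont
  have hconv : Convex ℝ K := by
    rintro _ ⟨μ, hμ, rfl⟩ _ ⟨ν, hν, rfl⟩ a b ha hb hab
    lift a to ℝ≥0 using ha
    lift b to ℝ≥0 using hb
    refine ⟨fun j => a • μ j + b • ν j, ?_, ?_⟩
    · intro j
      exact aux_mass_conv (by exact_mod_cast hab) (hμ j) (hν j)
    · exact auxPsi_conv μ ν a b
  obtain ⟨x, u, hu, hx⟩ := aux_weakDual_sep K hconv hKc.isClosed (StrongDual.toWeakDual L) (by
    rintro ⟨μ, hμ, h⟩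
    exact hcon μ hμ (StrongDual.toWeakDual.injective h))
  obtain ⟨ω, hω⟩ := aux_exists_max x
  set a := auxExt x ω with ha
  choose μ hμP hval using fun j : Fin 4 => aux_sel x ω (I ^ (j : ℕ))
  have h1 := hu _ ⟨μ, hμP, rfl⟩
  have h2 : (auxPsi μ x).re < u := h1
  rw [auxPsi_apply, Complex.re_sum] at h2
  simp only [hval, ← ha, Fin.sum_univ_four] at h2
  have h3 : ‖a‖ < u := by
    refine (Complex.norm_le_abs_re_add_abs_im a).trans_lt (lt_of_le_of_lt ?_ h2)
    simp only [Fin.val_zero, Fin.val_one, Fin.val_two, pow_zero, pow_one, one_mul, Complex.I_sq,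
      Fin.isValue, show ((3 : Fin 4) : ℕ) = 3 from rfl, Complex.I_pow_three]
    simp
    rcases abs_cases a.re with h | h <;> rcases abs_cases a.im with h' | h' <;>
    · rw [h.1, h'.1]
      linarith [le_max_left 0 a.re, le_max_right 0 a.re, le_max_left 0 (-a.re),
        le_max_right 0 (-a.re), le_max_left 0 a.im, le_max_right 0 a.im, le_max_left 0 (-a.im),
        le_max_right 0 (-a.im)]
  have h4 : (L x).re ≤ ‖x‖ := by
    refine (Complex.re_le_norm _).trans ((L.le_opNorm x).trans ?_)
    nlinarith [norm_nonneg x]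
  have h5 : u < (L x).re := hx
  linarith

noncomputable def auxF (μ : FiniteMeasure (sphere (0 : ℂ) 1)) (z : ℂ) : ℂ :=
  ∫ ω, (1 - z * conj (ω : ℂ))⁻¹ ∂(μ : Measure (sphere (0 : ℂ) 1))

theorem aux_sphere_norm (ω : sphere (0 : ℂ) 1) : ‖(ω : ℂ)‖ = 1 := mem_sphere_zero_iff_norm.1 ω.2

theorem aux_ker_cont {z : ℂ} (hz : ‖z‖ < 1) :
    Continuous fun ω : sphere (0 : ℂ) 1 => (1 - z * conj (ω : ℂ))⁻¹ := by
  apply Continuous.inv₀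
  · exact continuous_const.sub (continuous_const.mul
      (Complex.continuous_conj.comp continuous_subtype_val))
  · intro ω
    exact aux_den_ne hz (by rw [RCLike.norm_conj, aux_sphere_norm])

theorem auxF_cont {z : ℂ} (hz : ‖z‖ < 1) : Continuous fun μ => auxF μ z :=
  aux_cont_integral (aux_ker_cont hz)

theorem auxF_eq (μ : FiniteMeasure (sphere (0 : ℂ) 1)) (z : ball (0 : ℂ) 1) :
    conj (auxLam μ (auxK z)) = auxF μ z := by
  rw [auxLam_apply, ← integral_conj]
  unfold auxF
  congr 1
  ext ω
  rw [auxK_ext z (aux_sphere_norm ω).le]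
  simp

theorem aux_re_ker {z w : ℂ} (hz : ‖z‖ < 1) (hw : ‖w‖ ≤ 1) : 0 ≤ ((1 - z * w)⁻¹).re := by
  rw [Complex.inv_re]
  apply div_nonneg _ (Complex.normSq_nonneg _)
  have h1 : (z * w).re ≤ 1 := by
    refine (Complex.re_le_norm _).trans ?_
    rw [norm_mul]
    nlinarith [norm_nonneg z, norm_nonneg w]
  simp only [Complex.sub_re, Complex.one_re]
  linarith

theorem auxF_pos (μ : FiniteMeasure (sphere (0 : ℂ) 1)) : AuxPos (auxF μ) := by
  constructor
  · intro z₀ hz₀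
    have hz : ‖z₀‖ < 1 := mem_ball_zero_iff.1 hz₀
    set ε := (1 - ‖z₀‖) / 2 with hε
    have hε0 : 0 < ε := by simp only [hε]; linarith
    have hb : ∀ z ∈ ball z₀ ε, ‖z‖ ≤ 1 - ε := by
      intro z hz'
      have h1 : ‖z - z₀‖ < ε := mem_ball_iff_norm.1 hz'
      have h2 : ‖z‖ ≤ ‖z - z₀‖ + ‖z₀‖ := by simpa using norm_add_le (z - z₀) z₀
      linarith
    have hd := hasDerivAt_integral_of_dominated_loc_of_deriv_le
      (μ := (μ : Measure (sphere (0 : ℂ) 1)))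
      (F := fun (z : ℂ) (ω : sphere (0 : ℂ) 1) => (1 - z * conj (ω : ℂ))⁻¹)
      (F' := fun (z : ℂ) (ω : sphere (0 : ℂ) 1) => conj (ω : ℂ) * ((1 - z * conj (ω : ℂ))⁻¹) ^ 2)
      (x₀ := z₀) (bound := fun _ => (ε⁻¹) ^ 2) (s := ball z₀ ε) (ball_mem_nhds z₀ hε0)
      (by
        filter_upwards [ball_mem_nhds z₀ hε0] with z hz'
        exact (aux_integrable μ (aux_ker_cont (by linarith [hb z hz']))).aestronglyMeasurable)
      (aux_integrable μ (aux_ker_cont hz))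
      (by
        refine (aux_integrable μ ?_).aestronglyMeasurable
        exact (Complex.continuous_conj.comp continuous_subtype_val).mul ((aux_ker_cont hz).pow 2))
      (by
        refine ae_of_all _ fun ω z hz' => ?_
        have h1 := hb z hz'
        rw [norm_mul, RCLike.norm_conj, aux_sphere_norm, one_mul, norm_pow, norm_inv]
        have h2 : ε ≤ ‖1 - z * conj (ω : ℂ)‖ := by
          have h3 := norm_sub_norm_le 1 (z * conj (ω : ℂ))
          rw [norm_mul, RCLike.norm_conj, aux_sphere_norm, mul_one, norm_one] at h3
          linarith
        gcongr)
      (integrable_const _)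
      (by
        refine ae_of_all _ fun ω z hz' => ?_
        have h1 := hb z hz'
        have hne : 1 - z * conj (ω : ℂ) ≠ 0 :=
          aux_den_ne (by linarith) (by rw [RCLike.norm_conj, aux_sphere_norm])
        have h2 : HasDerivAt (fun z : ℂ => 1 - z * conj (ω : ℂ)) (-(1 * conj (ω : ℂ))) z :=
          ((hasDerivAt_id z).mul_const _).const_sub 1
        have h3 := h2.inv hne
        rw [one_mul, neg_neg, div_eq_mul_inv, ← inv_pow] at h3
        exact h3)
    exact hd.2.differentiableAt.differentiableWithinAt
  · intro z hz
    have hz : ‖z‖ < 1 := mem_ball_zero_iff.1 hz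
    have h : (auxF μ z).re = ∫ ω : sphere (0 : ℂ) 1, ((1 - z * conj (ω : ℂ))⁻¹).re
        ∂(μ : Measure (sphere (0 : ℂ) 1)) :=
      (integral_re (𝕜 := ℂ) (aux_integrable μ (aux_ker_cont hz))).symm
    rw [h]
    exact integral_nonneg fun ω => aux_re_ker hz (by rw [RCLike.norm_conj, aux_sphere_norm])

noncomputable def auxProd (l : List (ℂ → ℂ)) (z : ℂ) : ℝ := (l.map (fun G => ‖1 + G z‖)).prod

theorem auxProd_one_le (l : List (ℂ → ℂ)) (hl : ∀ G ∈ l, AuxPos G) {z : ℂ}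
    (hz : z ∈ ball (0 : ℂ) 1) : 1 ≤ auxProd l z := by
  induction l with
  | nil => simp [auxProd]
  | cons G l ih =>
    have h1 := ih fun G hG => hl G (List.mem_cons_of_mem _ hG)
    have h2 := aux_one_le ((hl G List.mem_cons_self).2 z hz)
    have : auxProd (G :: l) z = ‖1 + G z‖ * auxProd l z := by simp [auxProd]
    rw [this]
    nlinarith

theorem auxProd_append (l l' : List (ℂ → ℂ)) (z : ℂ) :
    auxProd (l ++ l') z = auxProd l z * auxProd l' z := by simp [auxProd]

/-- The subspace of functionals whose Cauchy transform is divisible by `φ`. -/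
noncomputable def auxW (φ : ℂ → ℂ) : Submodule ℂ (StrongDual ℂ auxA) where
  carrier := {L | ∃ l : List (ℂ → ℂ), (∀ G ∈ l, AuxPos G) ∧ ∃ M : ℝ, 0 ≤ M ∧
    ∀ z : ball (0 : ℂ) 1, ‖L (auxK z)‖ ≤ M * ‖φ z‖ * auxProd l z}
  add_mem' := by
    rintro L L' ⟨l, hl, M, hM, h⟩ ⟨l', hl', M', hM', h'⟩
    refine ⟨l ++ l', ?_, M + M', add_nonneg hM hM', fun z => ?_⟩
    · intro G hG
      rcases List.mem_append.1 hG with h | h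
      · exact hl G h
      · exact hl' G h
    · rw [auxProd_append]
      have h1 := auxProd_one_le l hl z.2
      have h2 := auxProd_one_le l' hl' z.2
      have h3 : auxProd l z ≤ auxProd l z * auxProd l' z := by nlinarith
      have h4 : auxProd l' z ≤ auxProd l z * auxProd l' z := by nlinarith
      calc ‖(L + L') (auxK z)‖ ≤ ‖L (auxK z)‖ + ‖L' (auxK z)‖ := norm_add_le _ _
        _ ≤ M * ‖φ z‖ * auxProd l z + M' * ‖φ z‖ * auxProd l' z := add_le_add (h z) (h' z)
        _ ≤ M * ‖φ z‖ * (auxProd l z * auxProd l' z) + M' * ‖φ z‖ * (auxProd l z * auxProd l' z) := by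
          gcongr
        _ = _ := by ring
  zero_mem' := ⟨[], by simp, 0, le_rfl, by simp⟩
  smul_mem' := by
    rintro c L ⟨l, hl, M, hM, h⟩
    refine ⟨l, hl, ‖c‖ * M, by positivity, fun z => ?_⟩
    have : ‖(c • L) (auxK z)‖ = ‖c‖ * ‖L (auxK z)‖ := by
      rw [← norm_mul]; rfl
    rw [this, mul_assoc, mul_assoc]
    exact mul_le_mul_of_nonneg_left (by rw [← mul_assoc]; exact h z) (norm_nonneg c)

theorem aux_le_prod (f : Fin 4 → ℂ) (hf : ∀ j, 0 ≤ (f j).re) :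
    1 ≤ ∏ j, ‖1 + f j‖ ∧ ‖∑ j : Fin 4, conj (I ^ (j : ℕ)) * f j‖ ≤ 4 * ∏ j, ‖1 + f j‖ := by
  have h1 : ∀ j, 1 ≤ ‖1 + f j‖ := fun j => aux_one_le (hf j)
  have hs : ∀ s : Finset (Fin 4), 1 ≤ ∏ j ∈ s, ‖1 + f j‖ := fun s =>
    Finset.prod_induction _ (fun x : ℝ => 1 ≤ x) (fun a b ha hb => by nlinarith) le_rfl
      fun j _ => h1 j
  refine ⟨hs _, ?_⟩
  have h2 : ∀ j, ‖f j‖ ≤ ∏ j, ‖1 + f j‖ := by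
    intro j
    have h3 : ‖f j‖ ≤ ‖1 + f j‖ := by
      rw [Complex.norm_def, Complex.norm_def]
      apply Real.sqrt_le_sqrt
      rw [Complex.normSq_apply, Complex.normSq_apply]
      simp only [Complex.add_re, Complex.add_im, Complex.one_re, Complex.one_im]
      nlinarith [hf j]
    rw [← Finset.mul_prod_erase Finset.univ _ (Finset.mem_univ j)]
    have := hs (Finset.univ.erase j)
    nlinarith [norm_nonneg (1 + f j)]
  refine (norm_sum_le _ _).trans ?_
  refine (Finset.sum_le_sum (g := fun _ => ∏ j, ‖1 + f j‖) fun j _ => ?_).trans (by simp)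
  rw [norm_mul, RCLike.norm_conj, norm_pow, Complex.norm_I, one_pow, one_mul]
  exact h2 j

noncomputable def auxS (μ : Fin 4 → FiniteMeasure (sphere (0 : ℂ) 1)) (z : ℂ) : ℂ :=
  ∑ j : Fin 4, conj (I ^ (j : ℕ)) * auxF (μ j) z

theorem auxS_eq (μ : Fin 4 → FiniteMeasure (sphere (0 : ℂ) 1)) (z : ball (0 : ℂ) 1) :
    conj (auxPsi μ (auxK z)) = auxS μ z := by
  rw [auxPsi_apply, map_sum]
  refine Finset.sum_congr rfl fun j _ => ?_
  rw [map_mul, auxF_eq]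

theorem auxS_norm (μ : Fin 4 → FiniteMeasure (sphere (0 : ℂ) 1)) (z : ball (0 : ℂ) 1) :
    ‖auxPsi μ (auxK z)‖ = ‖auxS μ z‖ := by
  rw [← auxS_eq, RCLike.norm_conj]

theorem auxW_key {φ : ℂ → ℂ} (hφ : IsInner φ) (h0 : ∀ z ∈ ball (0 : ℂ) 1, φ z ≠ 0)
    (μ : Fin 4 → FiniteMeasure (sphere (0 : ℂ) 1)) (hμ : auxPsi μ ∈ auxW φ)
    (z : ball (0 : ℂ) 1) :
    ‖auxPsi μ (auxK z)‖ ≤ 4 * ‖φ z‖ * ∏ j, ‖1 + auxF (μ j) z‖ := by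
  obtain ⟨l, hl, M, hM, h⟩ := hμ
  have hb := fun (z : ℂ) (hz : z ∈ ball (0 : ℂ) 1) =>
    aux_le_prod (fun j => auxF (μ j) z) (fun j => (auxF_pos (μ j)).2 z hz)
  have hne : ∀ z ∈ ball (0 : ℂ) 1, ∏ j, (1 + auxF (μ j) z) ≠ 0 := by
    intro z hz h
    have := (hb z hz).1
    rw [← norm_prod, h, norm_zero] at this
    linarith
  have hF : ∀ j, DifferentiableOn ℂ (auxF (μ j)) (ball 0 1) := fun j => (auxF_pos (μ j)).1
  have hq := aux_smirnov hφ l hl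
    (fun z => auxS μ z / (4 * φ z * ∏ j, (1 + auxF (μ j) z))) (M / 4)
    (by
      apply DifferentiableOn.div
      · unfold auxS
        apply DifferentiableOn.fun_sum
        intro j _
        exact (hF j).const_mul _
      · apply DifferentiableOn.mul (hφ.1.const_mul _)
        apply DifferentiableOn.fun_finsetProd
        intro j _
        exact (hF j).const_add _
      · intro z hz
        exact mul_ne_zero (mul_ne_zero (by norm_num) (h0 z hz)) (hne z hz))
    (by
      intro z hz
      have h1 := h ⟨z, hz⟩
      rw [auxS_norm] at h1
      have h2 := (hb z hz).1
      have h3 : 0 < ‖φ z‖ := norm_pos_iff.2 (h0 z hz)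
      have h4 := auxProd_one_le l hl hz
      rw [norm_div, norm_mul, norm_mul, norm_prod,
        div_le_iff₀ (by simp only [Complex.norm_ofNat]; positivity)]
      simp only [Complex.norm_ofNat]
      change _ ≤ M / 4 * auxProd l z * _
      refine h1.trans ?_
      have h5 : 0 ≤ M * ‖φ z‖ * auxProd l z := by positivity
      have : M / 4 * auxProd l z * (4 * ‖φ z‖ * ∏ j, ‖1 + auxF (μ j) z‖) =
        (M * ‖φ z‖ * auxProd l z) * ∏ j, ‖1 + auxF (μ j) z‖ := by ring
      rw [this]
      exact le_mul_of_one_le_right h5 h2)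
    (by
      intro z hz
      have h2 := hb z hz
      have h3 : 0 < ‖φ z‖ := norm_pos_iff.2 (h0 z hz)
      rw [norm_mul, norm_div, norm_mul, norm_mul, norm_prod, ← mul_div_assoc,
        div_le_one (by have := h2.1; simp only [Complex.norm_ofNat]; positivity)]
      simp only [Complex.norm_ofNat]
      have := mul_le_mul_of_nonneg_left h2.2 h3.le
      unfold auxS
      linarith)
    z z.2
  have h2 := (hb z z.2).1
  have h3 : 0 < ‖φ z‖ := norm_pos_iff.2 (h0 z z.2)
  rw [norm_div, norm_mul, norm_mul, norm_prod,
    div_le_one (by simp only [Complex.norm_ofNat]; positivity)] at hq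
  rw [auxS_norm]
  simpa using hq

theorem auxW_closed {φ : ℂ → ℂ} (hφ : IsInner φ) (h0 : ∀ z ∈ ball (0 : ℂ) 1, φ z ≠ 0) :
    IsClosed (auxBall (auxW φ)) := by
  set P' : Set (Fin 4 → FiniteMeasure (sphere (0 : ℂ) 1)) :=
    auxP ∩ ⋂ z : ball (0 : ℂ) 1,
      {μ | ‖auxPsi μ (auxK z)‖ ≤ 4 * ‖φ z‖ * ∏ j, ‖1 + auxF (μ j) z‖} with hP'
  have hP'c : IsCompact P' := by
    apply auxP_compact.inter_right
    apply isClosed_iInter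
    intro z
    apply isClosed_le
    · have h1 : Continuous fun μ => (StrongDual.toWeakDual (auxPsi μ)) (auxK z) :=
        (WeakDual.eval_continuous (auxK z)).comp auxPsi_cont
      exact h1.norm
    · apply continuous_const.mul
      apply continuous_finsetProd
      intro j _
      exact (continuous_const.add
        ((auxF_cont (mem_ball_zero_iff.1 z.2)).comp (continuous_apply j))).norm
  have e : auxBall (auxW φ) = ((fun μ => StrongDual.toWeakDual (auxPsi μ)) '' P') ∩
      (WeakDual.toStrongDual ⁻¹' closedBall 0 1) := by
    ext L
    constructor
    · rintro ⟨hLW, hL1⟩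
      refine ⟨?_, mem_closedBall_zero_iff.2 hL1⟩
      obtain ⟨μ, hμ, hμL⟩ := aux_decomp _ hL1
      refine ⟨μ, ⟨hμ, mem_iInter.2 fun z => ?_⟩, ?_⟩
      · exact auxW_key hφ h0 μ (by rw [hμL]; exact hLW) z
      · simp only [hμL]
        exact WeakDual.toStrongDual.symm_apply_apply L
    · rintro ⟨⟨μ, ⟨hμ, hμ'⟩, rfl⟩, hL1⟩
      refine ⟨?_, mem_closedBall_zero_iff.1 hL1⟩
      change auxPsi μ ∈ auxW φ
      refine ⟨List.ofFn fun j => auxF (μ j), ?_, 4, by norm_num, fun z => ?_⟩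
      · intro G hG
        obtain ⟨j, rfl⟩ := (List.mem_ofFn' _ _).1 hG
        exact auxF_pos _
      · have := mem_iInter.1 hμ' z
        refine le_trans this (le_of_eq ?_)
        simp [auxProd, List.ofFn_succ, Fin.prod_univ_succ]
  rw [e]
  exact (hP'c.image auxPsi_cont).isClosed.inter (WeakDual.isClosed_closedBall 0 1)

theorem aux_pairR_self (f : ℂ → ℂ) (r : ℝ) :
    (pairR f f r).re = (2 * π)⁻¹ * ∫ t in (0 : ℝ)..(2 * π), ‖f (r * Complex.exp (t * I))‖ ^ 2 := by
  unfold pairR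
  have h : ∀ t : ℝ, f (r * Complex.exp (t * I)) * conj (f (r * Complex.exp (t * I))) =
      ((‖f (r * Complex.exp (t * I))‖ ^ 2 : ℝ) : ℂ) := by
    intro t
    rw [Complex.mul_conj, Complex.normSq_eq_norm_sq]
  simp only [h]
  rw [intervalIntegral.integral_ofReal]
  have : (2 * (π : ℂ))⁻¹ = (((2 * π)⁻¹ : ℝ) : ℂ) := by push_cast; rfl
  rw [this, ← Complex.ofReal_mul, Complex.ofReal_re]

theorem aux_two_pi : (0 : ℝ) ≤ 2 * π := by positivity

theorem aux_memH2_mul {φ h : ℂ → ℂ} (hφ : IsInner φ) (hh : MemH2 h) :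
    MemH2 (fun w => φ w * h w) := by
  obtain ⟨hd, C, hC⟩ := hh
  have hd' := hφ.1.mul hd
  refine ⟨hd', C, fun r hr => le_trans ?_ (hC r hr)⟩
  rw [aux_pairR_self, aux_pairR_self]
  apply mul_le_mul_of_nonneg_left _ (by positivity)
  apply intervalIntegral.integral_mono_on aux_two_pi
  · exact ((aux_cont_circle hd'.continuousOn hr.1 hr.2).norm.pow 2).intervalIntegrable _ _
  · exact ((aux_cont_circle hd.continuousOn hr.1 hr.2).norm.pow 2).intervalIntegrable _ _
  · intro t _
    have h1 : ‖φ (r * Complex.exp (t * I))‖ < 1 :=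
      mem_ball_zero_iff.1 (hφ.2.1 (aux_cmem hr.1 hr.2 t))
    rw [norm_mul]
    apply pow_le_pow_left₀ (by positivity)
    exact mul_le_of_le_one_left (norm_nonneg _) h1.le

theorem aux_memH2_ext (x : auxA) : MemH2 (auxExt x) := by
  refine ⟨x.2, ‖x‖ ^ 2, fun r _ => ?_⟩
  rw [aux_pairR_self]
  have h : ∫ t in (0 : ℝ)..(2 * π), ‖auxExt x (r * Complex.exp (t * I))‖ ^ 2 ≤
      ∫ t in (0 : ℝ)..(2 * π), ‖x‖ ^ 2 := by
    apply intervalIntegral.integral_mono_on aux_two_pi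
    · apply Continuous.intervalIntegrable
      have := auxExt_cont (x : C(closedBall (0 : ℂ) 1, ℂ))
      fun_prop
    · exact continuous_const.intervalIntegrable _ _
    · intro t _
      exact pow_le_pow_left₀ (norm_nonneg _) (auxExt_norm_le _ _) 2
  rw [intervalIntegral.integral_const, sub_zero, smul_eq_mul] at h
  have hp : 0 < 2 * π := by positivity
  rw [inv_mul_le_iff₀ hp]
  exact h

theorem aux_pairR_bound (x : auxA) {f : ℂ → ℂ} (hf : DifferentiableOn ℂ f (ball 0 1)) {r : ℝ}
    (hr : r ∈ Ico (0 : ℝ) 1) {C : ℝ} (hC : (pairR f f r).re ≤ C) :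
    ‖pairR (auxExt x) f r‖ ≤ (1 + C) / 2 * ‖x‖ := by
  rw [aux_pairR_self] at hC
  have hp : 0 < 2 * π := by positivity
  have hcf := aux_cont_circle hf.continuousOn hr.1 hr.2
  have h1 : ‖∫ t in (0 : ℝ)..(2 * π), auxExt x (r * Complex.exp (t * I)) *
      conj (f (r * Complex.exp (t * I)))‖ ≤
      ∫ t in (0 : ℝ)..(2 * π), ‖x‖ * ((1 + ‖f (r * Complex.exp (t * I))‖ ^ 2) / 2) := by
    apply intervalIntegral.norm_integral_le_of_norm_le aux_two_pi
    · refine ae_of_all _ fun t _ => ?_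
      rw [norm_mul, RCLike.norm_conj]
      apply mul_le_mul (auxExt_norm_le _ _) _ (norm_nonneg _) (norm_nonneg _)
      nlinarith [sq_nonneg (‖f (r * Complex.exp (t * I))‖ - 1)]
    · apply Continuous.intervalIntegrable
      exact continuous_const.mul ((continuous_const.add (hcf.norm.pow 2)).div_const 2)
  have hsq : IntervalIntegrable (fun t : ℝ => ‖f (r * Complex.exp (t * I))‖ ^ 2) volume 0 (2 * π) :=
    (hcf.norm.pow 2).intervalIntegrable _ _
  rw [intervalIntegral.integral_const_mul, intervalIntegral.integral_div,
    intervalIntegral.integral_add (continuous_const.intervalIntegrable _ _)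
      hsq, intervalIntegral.integral_const, sub_zero,
    smul_eq_mul, mul_one] at h1
  unfold pairR
  have e : ‖(2 * (π : ℂ))⁻¹‖ = (2 * π)⁻¹ := by
    rw [norm_inv, norm_mul, Complex.norm_real, Real.norm_of_nonneg Real.pi_pos.le]; simp
  rw [norm_mul, e, inv_mul_le_iff₀ hp]
  rw [inv_mul_le_iff₀ hp] at hC
  refine h1.trans ?_
  have := mul_le_mul_of_nonneg_left hC (norm_nonneg x)
  nlinarith

theorem aux_functional {f : ℂ → ℂ} (hf : DifferentiableOn ℂ f (ball 0 1)) {r : ℝ}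
    (hr : r ∈ Ico (0 : ℝ) 1) {C : ℝ} (hC : (pairR f f r).re ≤ C) :
    ∃ L : StrongDual ℂ auxA, (∀ x : auxA, L x = pairR (auxExt x) f r) ∧ ‖L‖ ≤ |(1 + C) / 2| := by
  have hcf := aux_cont_circle hf.continuousOn hr.1 hr.2
  have hi : ∀ x : auxA, IntervalIntegrable (fun t : ℝ => auxExt x (r * Complex.exp (t * I)) *
      conj (f (r * Complex.exp (t * I)))) volume 0 (2 * π) := by
    intro x
    apply Continuous.intervalIntegrable
    have h1 := auxExt_cont (x : C(closedBall (0 : ℂ) 1, ℂ))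
    exact (h1.comp (by fun_prop : Continuous fun t : ℝ => (r : ℂ) * Complex.exp (t * I))).mul
      (Complex.continuous_conj.comp hcf)
  let L₀ : auxA →ₗ[ℂ] ℂ :=
    { toFun := fun x => pairR (auxExt x) f r
      map_add' := by
        intro x y
        unfold pairR
        rw [← mul_add, ← intervalIntegral.integral_add (hi x) (hi y)]
        congr 2
        ext t
        exact add_mul (auxExt x _) (auxExt y _) _
      map_smul' := by
        intro c x
        unfold pairR
        rw [RingHom.id_apply, smul_eq_mul, mul_left_comm, ← intervalIntegral.integral_const_mul c]
        congr 1
        apply intervalIntegral.integral_congr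
        intro t _
        exact mul_assoc c (auxExt x _) _ }
  refine ⟨L₀.mkContinuous |(1 + C) / 2| fun x => ?_, fun x => rfl,
    LinearMap.mkContinuous_norm_le _ (abs_nonneg _) _⟩
  refine (aux_pairR_bound x hf hr hC).trans ?_
  exact mul_le_mul_of_nonneg_right (le_abs_self _) (norm_nonneg x)

theorem aux_conj_integral (f : ℝ → ℂ) (a b : ℝ) :
    conj (∫ t in a..b, f t) = ∫ t in a..b, conj (f t) := by
  simp only [intervalIntegral]
  rw [map_sub, integral_conj, integral_conj]

theorem aux_repro {f : ℂ → ℂ} (hf : DifferentiableOn ℂ f (ball 0 1)) {r : ℝ}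
    (hr : r ∈ Ioo (0 : ℝ) 1) (z : ball (0 : ℂ) 1) :
    conj (pairR (auxExt (auxK z)) f r) = f (r ^ 2 * z) := by
  have hz : ‖(z : ℂ)‖ < 1 := mem_ball_zero_iff.1 z.2
  have hw : ‖(r : ℂ) ^ 2 * z‖ < r := by
    rw [norm_mul, norm_pow, Complex.norm_real, Real.norm_of_nonneg hr.1.le]
    nlinarith [hr.1, hr.2, norm_nonneg (z : ℂ), mul_pos hr.1 hr.1]
  rw [← aux_cauchy hf hr.2 hw]
  unfold pairR
  rw [map_mul, aux_conj_integral]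
  congr 1
  · simp only [map_inv₀, map_mul, Complex.conj_ofReal, map_ofNat]
  · congr 1
    ext t
    have hn : ‖(r : ℂ) * Complex.exp (t * I)‖ ≤ 1 :=
      (mem_ball_zero_iff.1 (aux_cmem hr.1.le hr.2 t)).le
    rw [auxK_ext z hn, map_mul, Complex.conj_conj]
    congr 1
    have he : conj (Complex.exp (t * I)) = (Complex.exp (t * I))⁻¹ := by
      rw [← Complex.exp_conj, ← Complex.exp_neg]
      simp
    rw [map_inv₀, map_sub, map_mul, map_mul, he, map_one, Complex.conj_conj, Complex.conj_ofReal]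
    have h0 := Complex.exp_ne_zero (t * I)
    have hr0 : (r : ℂ) ≠ 0 := by exact_mod_cast hr.1.ne'
    have hw2 : (r : ℂ) * Complex.exp (t * I) - r ^ 2 * z ≠ 0 := by
      intro h
      have h1 : ‖(r : ℂ) * Complex.exp (t * I)‖ = r := by
        rw [norm_mul, Complex.norm_exp_ofReal_mul_I, Complex.norm_real,
          Real.norm_of_nonneg hr.1.le, mul_one]
      rw [sub_eq_zero.1 h] at h1
      linarith
    rw [inv_eq_iff_eq_inv, inv_div]
    field_simp

theorem aux_limit {f : ℂ → ℂ} (hf : MemH2 f) (U : Ultrafilter ℝ) (hU : (U : Filter ℝ) ≤ 𝓝[<] 1) :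
    ∃ L : StrongDual ℂ auxA,
      (∀ x : auxA, Tendsto (fun r => pairR (auxExt x) f r) U (𝓝 (L x))) ∧
      ∀ z : ball (0 : ℂ) 1, conj (L (auxK z)) = f z := by
  obtain ⟨hd, C, hC⟩ := hf
  have hex : ∀ r : ℝ, ∃ L : StrongDual ℂ auxA, ‖L‖ ≤ |(1 + C) / 2| ∧
      (r ∈ Ioo (0 : ℝ) 1 → ∀ x : auxA, L x = pairR (auxExt x) f r) := by
    intro r
    by_cases hr : r ∈ Ioo (0 : ℝ) 1
    · obtain ⟨L, h1, h2⟩ := aux_functional hd ⟨hr.1.le, hr.2⟩ (hC r ⟨hr.1.le, hr.2⟩)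
      exact ⟨L, h2, fun _ => h1⟩
    · exact ⟨0, ContinuousLinearMap.opNorm_zero.le.trans (abs_nonneg _), fun h => absurd h hr⟩
  choose T hT1 hT2 using hex
  have hcomp := WeakDual.isCompact_closedBall (𝕜 := ℂ) (E := auxA) 0 |(1 + C) / 2|
  let V : Ultrafilter (WeakDual ℂ auxA) := U.map fun r => StrongDual.toWeakDual (T r)
  obtain ⟨L, -, hL⟩ := hcomp.ultrafilter_le_nhds V (by
    rw [le_principal_iff]
    exact Eventually.of_forall (f := (U : Filter ℝ)) fun r => mem_closedBall_zero_iff.2 (hT1 r))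
  have hev : ∀ᶠ r in (U : Filter ℝ), r ∈ Ioo (0 : ℝ) 1 :=
    hU (Ioo_mem_nhdsLT one_pos)
  have hlim : ∀ x : auxA, Tendsto (fun r => pairR (auxExt x) f r) U (𝓝 (L x)) := by
    intro x
    have h1 : Tendsto (fun r => StrongDual.toWeakDual (T r)) U (𝓝 L) := hL
    have h2 := ((WeakDual.eval_continuous x).tendsto L).comp h1
    refine h2.congr' ?_
    filter_upwards [hev] with r hr
    exact hT2 r hr x
  refine ⟨WeakDual.toStrongDual L, hlim, fun z => ?_⟩
  have h1 := (Complex.continuous_conj.tendsto _).comp (hlim (auxK z))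
  refine tendsto_nhds_unique h1 ?_
  have hc : ContinuousAt f z := (hd.differentiableAt (isOpen_ball.mem_nhds z.2)).continuousAt
  have h3 : Tendsto (fun r : ℝ => (r : ℂ) ^ 2 * (z : ℂ)) (𝓝 1) (𝓝 (z : ℂ)) := by
    have : Continuous fun r : ℝ => (r : ℂ) ^ 2 * (z : ℂ) := by fun_prop
    simpa using this.tendsto 1
  have h4 : Tendsto (fun r : ℝ => f ((r : ℂ) ^ 2 * (z : ℂ))) U (𝓝 (f z)) :=
    (hc.tendsto.comp h3).mono_left (hU.trans nhdsWithin_le_nhds)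
  refine h4.congr' ?_
  filter_upwards [hev] with r hr
  exact (aux_repro hd hr z).symm

theorem aux_growth {h : ℂ → ℂ} (hh : MemH2 h) :
    ∃ l : List (ℂ → ℂ), (∀ G ∈ l, AuxPos G) ∧ ∃ M : ℝ, 0 ≤ M ∧
      ∀ z ∈ ball (0 : ℂ) 1, ‖h z‖ ≤ M * auxProd l z := by
  obtain ⟨L, -, hL⟩ := aux_limit hh (Ultrafilter.of (𝓝[<] (1 : ℝ))) (Ultrafilter.of_le _)
  set c : ℝ := ‖L‖ + 1 with hc
  have hc0 : 0 < c := by positivity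
  obtain ⟨μ, -, hμ⟩ := aux_decomp (((c⁻¹ : ℝ) : ℂ) • L) (by
    refine (ContinuousLinearMap.opNorm_smul_le _ _).trans ?_
    rw [Complex.norm_real, Real.norm_of_nonneg (by positivity), inv_mul_le_iff₀ hc0]
    linarith)
  refine ⟨List.ofFn fun j => auxF (μ j), ?_, 4 * c, by positivity, fun z hz => ?_⟩
  · intro G hG
    obtain ⟨j, rfl⟩ := (List.mem_ofFn' _ _).1 hG
    exact auxF_pos _
  · have h1 := (aux_le_prod (fun j => auxF (μ j) z) (fun j => (auxF_pos (μ j)).2 z hz)).2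
    have h2 : ‖auxPsi μ (auxK ⟨z, hz⟩)‖ = c⁻¹ * ‖h z‖ := by
      rw [hμ]
      change ‖((c⁻¹ : ℝ) : ℂ) * L (auxK ⟨z, hz⟩)‖ = _
      rw [norm_mul, Complex.norm_real, Real.norm_of_nonneg (by positivity), ← hL ⟨z, hz⟩,
        RCLike.norm_conj]
    rw [auxS_norm] at h2
    change ‖auxS μ z‖ ≤ _ at h1
    rw [h2, inv_mul_le_iff₀ hc0] at h1
    refine h1.trans (le_of_eq ?_)
    simp [auxProd, List.ofFn_succ, Fin.prod_univ_succ]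
    ring

theorem aux_memModel {φ : ℂ → ℂ} (hφ : IsInner φ) (g : auxA) (hg : ∀ M ∈ auxW φ, M g = 0) :
    MemModel φ (auxExt g) := by
  refine ⟨aux_memH2_ext g, fun h hh => ?_⟩
  rw [tendsto_iff_ultrafilter]
  intro U hU
  obtain ⟨L, hL1, hL2⟩ := aux_limit (aux_memH2_mul hφ hh) U hU
  have hLW : L ∈ auxW φ := by
    obtain ⟨l, hl, M, hM, hb⟩ := aux_growth hh
    refine ⟨l, hl, M, hM, fun z => ?_⟩
    rw [← RCLike.norm_conj, hL2, norm_mul]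
    have := mul_le_mul_of_nonneg_left (hb z z.2) (norm_nonneg (φ z))
    linarith
  have := hL1 g
  rwa [hg L hLW] at this

theorem aux_memModel_zero {φ : ℂ → ℂ} (hφ : IsInner φ) (a : ball (0 : ℂ) 1) (ha : φ a = 0) :
    MemModel φ (auxExt (auxK a)) := by
  refine ⟨aux_memH2_ext _, fun h hh => ?_⟩
  rw [tendsto_iff_ultrafilter]
  intro U hU
  obtain ⟨L, hL1, hL2⟩ := aux_limit (aux_memH2_mul hφ hh) U hU
  have h1 := hL2 a
  simp only [ha, zero_mul] at h1
  have h2 : L (auxK a) = 0 := by simpa using h1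
  have := hL1 (auxK a)
  rwa [h2] at this

noncomputable def auxEv (ω : sphere (0 : ℂ) 1) : StrongDual ℂ auxA :=
  LinearMap.mkContinuous
    { toFun := fun x => auxExt x ω
      map_add' := fun _ _ => rfl
      map_smul' := fun _ _ => rfl } 1 (fun x => by
        rw [one_mul]; exact auxExt_norm_le _ _)

theorem auxEv_notMem {φ : ℂ → ℂ} (hφ : IsInner φ) (h0 : ∀ z ∈ ball (0 : ℂ) 1, φ z ≠ 0)
    (ω : sphere (0 : ℂ) 1) : auxEv ω ∉ auxW φ := by
  rintro ⟨l, hl, M, hM, h⟩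
  have hq := aux_smirnov hφ l hl (fun z => (φ z)⁻¹) (2 * M) (hφ.1.inv h0)
    (by
      intro z hz
      have h1 := h ⟨z, hz⟩
      have h2 : auxEv ω (auxK ⟨z, hz⟩) = (1 - conj z * ω)⁻¹ := auxK_ext _ (aux_sphere_norm ω).le
      have hz1 : ‖z‖ < 1 := mem_ball_zero_iff.1 hz
      have h3 : (1 - conj z * (ω : ℂ)) ≠ 0 :=
        aux_den_ne (by rwa [RCLike.norm_conj]) (aux_sphere_norm ω).le
      have h4 : ‖1 - conj z * (ω : ℂ)‖ ≤ 2 := by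
        refine (norm_sub_le _ _).trans ?_
        rw [norm_mul, RCLike.norm_conj, aux_sphere_norm, norm_one]
        linarith
      have h5 := auxProd_one_le l hl hz
      have h6 : 0 < ‖φ z‖ := norm_pos_iff.2 (h0 z hz)
      rw [h2, norm_inv, inv_le_iff_one_le_mul₀ (norm_pos_iff.2 h3)] at h1
      change _ ≤ 2 * M * auxProd l z
      rw [norm_inv, inv_le_iff_one_le_mul₀ h6]
      refine h1.trans ?_
      have h7 : 0 ≤ M * ‖φ z‖ * auxProd l z := by positivity
      change M * ‖φ z‖ * auxProd l z * _ ≤ _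
      have := mul_le_mul_of_nonneg_left h4 h7
      linarith)
    (by
      intro z hz
      rw [mul_inv_cancel₀ (h0 z hz), norm_one])
    0 (by simp)
  have h1 : ‖φ 0‖ < 1 := mem_ball_zero_iff.1 (hφ.2.1 (by simp))
  have h2 : 0 < ‖φ 0‖ := norm_pos_iff.2 (h0 0 (by simp))
  rw [norm_inv] at hq
  have := one_lt_inv_iff₀.2 ⟨h2, h1⟩
  linarith

theorem aux_exists {φ : ℂ → ℂ} (hφ : IsInner φ) (ω : sphere (0 : ℂ) 1) :
    ∃ x : auxA, MemModel φ (auxExt x) ∧ auxExt x ω ≠ 0 := by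
  by_cases h0 : ∀ z ∈ ball (0 : ℂ) 1, φ z ≠ 0
  · obtain ⟨g, hg1, hg2⟩ := aux_ks (auxW φ) (auxW_closed hφ h0) (auxEv ω) (auxEv_notMem hφ h0 ω)
    exact ⟨g, aux_memModel hφ g hg1, hg2⟩
  · push Not at h0
    obtain ⟨a, ha, ha0⟩ := h0
    refine ⟨auxK ⟨a, ha⟩, aux_memModel_zero hφ ⟨a, ha⟩ ha0, ?_⟩
    rw [auxK_ext _ (aux_sphere_norm ω).le]
    exact inv_ne_zero (aux_den_ne (by rw [RCLike.norm_conj]; exact mem_ball_zero_iff.1 ha)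
      (aux_sphere_norm ω).le)

theorem aux_norm_limit (x : auxA) :
    Tendsto (fun r => (pairR (auxExt x) (auxExt x) r).re) (𝓝[<] (1 : ℝ))
      (𝓝 (pairR (auxExt x) (auxExt x) 1).re) := by
  have hx := auxExt_cont (x : C(closedBall (0 : ℂ) 1, ℂ))
  have h : Continuous fun r => pairR (auxExt x) (auxExt x) r := by
    unfold pairR
    apply continuous_const.mul
    apply intervalIntegral.continuous_parametric_intervalIntegral_of_continuous'
    have h1 : Continuous fun p : ℝ × ℝ => (p.1 : ℂ) * Complex.exp ((p.2 : ℂ) * I) := by fun_prop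
    exact (hx.comp h1).mul (Complex.continuous_conj.comp (hx.comp h1))
  exact ((Complex.continuous_re.comp h).tendsto 1).mono_left nhdsWithin_le_nhds

theorem aux_iso_ext {φ : ℂ → ℂ} {x : auxA} (hx : MemModel φ (auxExt x))
    {μ : FiniteMeasure (sphere (0 : ℂ) 1)} (hμ : μ ∈ IsoSet φ) :
    (∫ ω : sphere (0 : ℂ) 1, ‖auxExt x ω‖ ^ 2 ∂(μ : Measure (sphere (0 : ℂ) 1))) =
      (pairR (auxExt x) (auxExt x) 1).re :=
  hμ _ (auxExt_cont _).continuousOn x.2 hx _ (aux_norm_limit x)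

theorem aux_integrable_real (μ : FiniteMeasure (sphere (0 : ℂ) 1)) {f : sphere (0 : ℂ) 1 → ℝ}
    (hf : Continuous f) : Integrable f (μ : Measure (sphere (0 : ℂ) 1)) :=
  (BoundedContinuousFunction.mkOfCompact ⟨f, hf⟩).integrable _

theorem aux_mass_bound {φ : ℂ → ℂ} (hφ : IsInner φ) :
    ∃ C : ℝ, ∀ μ ∈ IsoSet φ, (μ : Measure (sphere (0 : ℂ) 1)).real univ ≤ C := by
  refine isCompact_univ.induction_on (p := fun s : Set (sphere (0 : ℂ) 1) =>
    ∃ C : ℝ, ∀ μ ∈ IsoSet φ, (μ : Measure (sphere (0 : ℂ) 1)).real s ≤ C) ?_ ?_ ?_ ?_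
  · exact ⟨0, by simp⟩
  · rintro s t hst ⟨C, hC⟩
    exact ⟨C, fun μ hμ => (measureReal_mono hst).trans (hC μ hμ)⟩
  · rintro s t ⟨C, hC⟩ ⟨C', hC'⟩
    exact ⟨C + C', fun μ hμ => (measureReal_union_le s t).trans (add_le_add (hC μ hμ) (hC' μ hμ))⟩
  · intro ω _
    obtain ⟨x, hx, hne⟩ := aux_exists hφ ω
    have hcont : Continuous fun w : sphere (0 : ℂ) 1 => ‖auxExt x w‖ ^ 2 :=
      (((auxExt_cont x).comp continuous_subtype_val).norm).pow 2
    set c := ‖auxExt x ω‖ ^ 2 / 2 with hc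
    have hpos : 0 < ‖auxExt x ω‖ ^ 2 := by
      have := norm_pos_iff.2 hne
      positivity
    have hc0 : 0 < c := by positivity
    refine ⟨{w : sphere (0 : ℂ) 1 | c ≤ ‖auxExt x w‖ ^ 2}, ?_,
      (pairR (auxExt x) (auxExt x) 1).re / c, fun μ hμ => ?_⟩
    · apply mem_nhdsWithin_of_mem_nhds
      filter_upwards [hcont.continuousAt.eventually_const_lt
        (show c < ‖auxExt x ω‖ ^ 2 by linarith)] with w hw
      exact hw.le
    · rw [le_div_iff₀ hc0, mul_comm, ← aux_iso_ext hx hμ]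
      exact mul_meas_ge_le_integral_of_nonneg (ae_of_all _ fun w => by positivity)
        (aux_integrable_real μ hcont) c

theorem aux_sphere_cont {g : ℂ → ℂ} (hg : ContinuousOn g (closedBall (0 : ℂ) 1)) :
    Continuous fun ω : sphere (0 : ℂ) 1 => ‖g ω‖ ^ 2 :=
  ((hg.comp_continuous continuous_subtype_val
    (fun ω => sphere_subset_closedBall ω.2)).norm).pow 2

theorem aux_cont_integral_real {f : sphere (0 : ℂ) 1 → ℝ} (hf : Continuous f) :
    Continuous (fun μ : FiniteMeasure (sphere (0 : ℂ) 1) =>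
      ∫ ω, f ω ∂(μ : Measure (sphere (0 : ℂ) 1))) := by
  rw [continuous_iff_continuousAt]
  intro μ
  exact FiniteMeasure.tendsto_iff_forall_integral_tendsto.1 tendsto_id
    (BoundedContinuousFunction.mkOfCompact ⟨f, hf⟩)

theorem aux_iso_closed (φ : ℂ → ℂ) : IsClosed (IsoSet φ) := by
  have e : IsoSet φ = ⋂ (g : ℂ → ℂ) (_ : ContinuousOn g (closedBall (0 : ℂ) 1))
      (_ : DifferentiableOn ℂ g (ball (0 : ℂ) 1)) (_ : MemModel φ g) (N : ℝ)
      (_ : Tendsto (fun r => (pairR g g r).re) (𝓝[<] (1 : ℝ)) (𝓝 N)),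
      {μ : FiniteMeasure (sphere (0 : ℂ) 1) |
        (∫ ω : sphere (0 : ℂ) 1, ‖g ω‖ ^ 2 ∂(μ : Measure (sphere (0 : ℂ) 1))) = N} := by
    ext μ
    simp only [mem_iInter]
    rfl
  rw [e]
  refine isClosed_iInter fun g => isClosed_iInter fun hg => isClosed_iInter fun _ =>
    isClosed_iInter fun _ => isClosed_iInter fun N => isClosed_iInter fun _ => ?_
  exact isClosed_eq (aux_cont_integral_real (aux_sphere_cont hg)) continuous_const

theorem aux_iso_convex (φ : ℂ → ℂ) : Convex ℝ≥0 (IsoSet φ) := by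
  intro μ hμ ν hν a b _ _ hab g hg hd hm N hN
  have h1 := hμ g hg hd hm N hN
  have h2 := hν g hg hd hm N hN
  have hc := aux_sphere_cont hg
  rw [FiniteMeasure.toMeasure_add, integral_add_measure (aux_integrable_real _ hc)
    (aux_integrable_real _ hc), FiniteMeasure.toMeasure_smul, FiniteMeasure.toMeasure_smul,
    integral_smul_nnreal_measure, integral_smul_nnreal_measure, h1, h2, ← add_smul, hab, one_smul]

/-- for a nonconstant inner function `φ`, the set `Iso(φ)` is
convex and compact in the weak-* topology (the topology of weak convergence of
finite measures on the compact space `𝕋`). -/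
theorem isoSet_convex_and_weakstar_compact
    (φ : ℂ → ℂ) (hφ : IsInner φ)
    (hnc : ¬ ∃ a : ℂ, Set.EqOn φ (fun _ => a) (ball (0:ℂ) 1)) :
    Convex ℝ≥0 (IsoSet φ) ∧ IsCompact (IsoSet φ) := by
  refine ⟨aux_iso_convex φ, ?_⟩
  obtain ⟨C, hC⟩ := aux_mass_bound hφ
  refine (isCompact_setOfPred_finiteMeasure_le_of_compactSpace (sphere (0 : ℂ) 1)
    C.toNNReal).of_isClosed_subset (aux_iso_closed φ) fun μ hμ => ?_
  change μ.mass ≤ C.toNNReal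
  have h := hC μ hμ
  rw [← NNReal.coe_le_coe]
  exact le_trans h (Real.le_coe_toNNReal C)
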